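/- Let ε>0, ℓ>0, f ∈ C²(ℝ) and u_- > u_+. Set m = min_{u∈[u_+,u_-]} f(u), M = max_{u∈[u_+,u_-]} f(u), L_- = ∫_{u_+}^{u_-} 2(M−f(s)) / [1 + √(1−4(f(s)−M)²)] ds, and L_+ = ∫_{u_+}^{u_-} [1 − 2(f(s)−m)] / [1 + 2√((f(s)−m)(1−(f(s)−m)))] ds. Then there exists a unique strictly decreasing C¹ function v on [−ℓ,ℓ] with v(−ℓ)=u_-, v(ℓ)=u_+, satisfying v'(x) < −ε^{-1} for all x, for which there is a constant c∈ℝ such that ε v'(x)/(1+ε² v'(x)²) = f(v(x)) + c for all x∈[−ℓ,ℓ], if and only if M−m < 1/2 and L_- < 2ℓ/ε < L_+. -/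

import Mathlib

open Set Filter Topology MeasureTheory

/-- `v` (with derivative `v'`) is a strictly decreasing C¹ solution, with slope below
`-ε⁻¹`, of the stationary problem `(ε v_x/(1+ε²v_x²))_x = (f(v))_x`, `v(±ℓ)=u_±`,
i.e. there is a constant `c` with `ε v'/(1+ε²v'²) = f(v) + c` on `[-ℓ,ℓ]`. -/
def IsDecSteadyNMsteep (l ε : ℝ) (f : ℝ → ℝ) (um up : ℝ) (v v' : ℝ → ℝ) (c : ℝ) : Prop :=
  StrictAntiOn v (Set.Icc (-l) l) ∧
  ContinuousOn v' (Set.Icc (-l) l) ∧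
  (∀ x ∈ Set.Icc (-l) l, HasDerivAt v (v' x) x) ∧
  v (-l) = um ∧ v l = up ∧
  (∀ x ∈ Set.Icc (-l) l, v' x < -ε⁻¹) ∧
  ∀ x ∈ Set.Icc (-l) l, ε * v' x / (1 + ε ^ 2 * v' x ^ 2) = f (v x) + c

/-- The reciprocal slope `G ∈ [0, 1]` solving `G / (1 + G ^ 2) = w`. -/
noncomputable def recipSlope (w : ℝ) : ℝ := 2 * w / (1 + Real.sqrt (1 - 4 * w ^ 2))

theorem one_add_sqrt_pos (y : ℝ) : 0 < 1 + Real.sqrt y := by positivity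

theorem continuous_recipSlope : Continuous recipSlope := by
  unfold recipSlope
  exact Continuous.div (by fun_prop) (by fun_prop) fun w => (one_add_sqrt_pos _).ne'

theorem recipSlope_pos {w : ℝ} (hw : 0 < w) : 0 < recipSlope w :=
  div_pos (by linarith) (one_add_sqrt_pos _)

theorem recipSlope_strictMonoOn : StrictMonoOn recipSlope (Ici 0) := by
  intro a ha b hb hab
  have ha0 : 0 ≤ a := ha
  have hsq : Real.sqrt (1 - 4 * b ^ 2) ≤ Real.sqrt (1 - 4 * a ^ 2) :=
    Real.sqrt_le_sqrt (by nlinarith)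
  refine div_lt_div₀ (by linarith) (by linarith) (by linarith) (one_add_sqrt_pos _)

theorem recipSlope_half : recipSlope (1 / 2) = 1 := by
  norm_num [recipSlope]

theorem recipSlope_div_one_add_sq {w : ℝ} (h0 : 0 ≤ w) (h1 : w ≤ 1 / 2) :
    recipSlope w / (1 + recipSlope w ^ 2) = w := by
  have hr := Real.sq_sqrt (show 0 ≤ 1 - 4 * w ^ 2 by nlinarith)
  have hr1 := one_add_sqrt_pos (1 - 4 * w ^ 2)
  unfold recipSlope
  set r := Real.sqrt (1 - 4 * w ^ 2)
  rw [div_eq_iff (by positivity)]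
  field_simp
  nlinarith

theorem recipSlope_of_div_one_add_sq {g : ℝ} (h0 : 0 ≤ g) (h1 : g ≤ 1) :
    recipSlope (g / (1 + g ^ 2)) = g := by
  have hg : 0 < 1 + g ^ 2 := by positivity
  have hr : Real.sqrt (1 - 4 * (g / (1 + g ^ 2)) ^ 2) = (1 - g ^ 2) / (1 + g ^ 2) := by
    have h2 : 1 - 4 * (g / (1 + g ^ 2)) ^ 2 = ((1 - g ^ 2) / (1 + g ^ 2)) ^ 2 := by
      field_simp; ring
    rw [h2, Real.sqrt_sq (div_nonneg (by nlinarith) hg.le)]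
  unfold recipSlope
  rw [hr]
  field_simp
  ring

/-- The primitive of a continuous function bounded below by a positive constant has a
differentiable global inverse. -/
theorem exists_inverse_primitive {g : ℝ → ℝ} (hg : Continuous g) {δ : ℝ} (hδ : 0 < δ)
    (hle : ∀ u, δ ≤ g u) (a : ℝ) :
    ∃ J : ℝ → ℝ, StrictMono J ∧ Continuous J ∧ (∀ u, J (∫ s in a..u, g s) = u) ∧
      ∀ y, HasDerivAt J (g (J y))⁻¹ y := by
  set H : ℝ → ℝ := fun u => ∫ s in a..u, g s with hH
  have hd : ∀ u, HasDerivAt H (g u) u := fun u =>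
    intervalIntegral.integral_hasDerivAt_right (hg.intervalIntegrable _ _)
      hg.stronglyMeasurable.stronglyMeasurableAtFilter hg.continuousAt
  have hdiff : Differentiable ℝ H := fun u => (hd u).differentiableAt
  have hmono : StrictMono H := strictMono_of_hasDerivAt_pos hd fun u => hδ.trans_le (hle u)
  have hgrow : ∀ x y, x ≤ y → δ * (y - x) ≤ H y - H x := fun x y hxy =>
    mul_sub_le_image_sub_of_le_deriv hdiff (fun u => by rw [(hd u).deriv]; exact hle u) hxy
  have htop : Tendsto H atTop atTop := by
    refine tendsto_atTop_mono' atTop (f₁ := fun u => H a + δ * (u - a)) ?_ ?_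
    · filter_upwards [eventually_ge_atTop a] with u hu
      linarith [hgrow a u hu]
    · exact tendsto_atTop_add_const_left _ _
        ((tendsto_atTop_add_const_right _ (-a) tendsto_id).const_mul_atTop hδ)
  have hbot : Tendsto H atBot atBot := by
    refine tendsto_atBot_mono' atBot (f₁ := fun u => H a + δ * (u - a)) ?_ ?_
    · filter_upwards [eventually_le_atBot a] with u hu
      linarith [hgrow u a hu]
    · exact tendsto_atBot_add_const_left _ _
        ((tendsto_atBot_add_const_right _ (-a) tendsto_id).const_mul_atBot hδ)
  let e := hmono.orderIsoOfSurjective H (hdiff.continuous.surjective htop hbot)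
  have he : ∀ u, e.symm (H u) = u := fun u => e.symm_apply_apply u
  have he' : ∀ y, H (e.symm y) = y := fun y => e.apply_symm_apply y
  refine ⟨e.symm, e.symm.strictMono, e.symm.continuous, he, fun y => ?_⟩
  exact (hd _).of_local_left_inverse e.symm.continuous.continuousAt
    (hδ.trans_le (hle _)).ne' (Eventually.of_forall he')

/-- The time, in units of `ε`, that a steep solution takes to descend from `b` to `a`, as a function of the integration constant. -/
noncomputable def travelTime (f : ℝ → ℝ) (a b k : ℝ) : ℝ := ∫ s in a..b, recipSlope (k - f s)

theorem continuous_travelTime {f : ℝ → ℝ} (hf : Continuous f) (a b : ℝ) :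
    Continuous (travelTime f a b) := by
  unfold travelTime
  apply intervalIntegral.continuous_parametric_intervalIntegral_of_continuous'
  exact continuous_recipSlope.comp (by fun_prop)

theorem travelTime_strictMonoOn {f : ℝ → ℝ} (hf : Continuous f) {a b M : ℝ} (hab : a < b)
    (hM : ∀ u ∈ Icc a b, f u ≤ M) : StrictMonoOn (travelTime f a b) (Ici M) := by
  intro k hk k' hk' hkk
  have hk0 : M ≤ k := hk
  have hc : ∀ k, Continuous fun s => recipSlope (k - f s) := fun k =>
    continuous_recipSlope.comp (by fun_prop)
  have key : ∀ s ∈ Icc a b, recipSlope (k - f s) < recipSlope (k' - f s) := fun s hs =>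
    recipSlope_strictMonoOn (mem_Ici.2 (by linarith [hM s hs]))
      (mem_Ici.2 (by linarith [hM s hs])) (by linarith)
  exact intervalIntegral.integral_lt_integral_of_continuousOn_of_le_of_exists_lt hab
    (hc k).continuousOn (hc k').continuousOn (fun s hs => (key s (Ioc_subset_Icc_self hs)).le)
    ⟨a, left_mem_Icc.2 hab.le, key a (left_mem_Icc.2 hab.le)⟩

theorem IsDecSteadyNMsteep.mem_Icc {l ε um up c : ℝ} {f v v' : ℝ → ℝ} (hl : 0 < l)
    (h : IsDecSteadyNMsteep l ε f um up v v' c) {x : ℝ} (hx : x ∈ Icc (-l) l) :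
    v x ∈ Icc up um := by
  obtain ⟨hanti, -, -, h1, h2, -⟩ := h
  rw [← h1, ← h2]
  exact ⟨hanti.antitoneOn hx (right_mem_Icc.2 (by linarith)) hx.2,
    hanti.antitoneOn (left_mem_Icc.2 (by linarith)) hx hx.1⟩

/-- Inverting the flux along a steep solution. -/
theorem IsDecSteadyNMsteep.slope {l ε um up c : ℝ} {f v v' : ℝ → ℝ} (hε : 0 < ε)
    (h : IsDecSteadyNMsteep l ε f um up v v' c) {x : ℝ} (hx : x ∈ Icc (-l) l) :
    -c - f (v x) ∈ Ioo 0 (1 / 2) ∧ recipSlope (-c - f (v x)) * v' x = -ε⁻¹ := by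
  obtain ⟨-, -, -, -, -, hs, hQ⟩ := h
  have hs := hs x hx
  have hQ := hQ x hx
  have hp : ε * v' x < -1 := by
    have := mul_lt_mul_of_pos_left hs hε
    rwa [mul_neg, mul_inv_cancel₀ hε.ne'] at this
  set p := -(ε * v' x) with hpdef
  have hp1 : 1 < p := by linarith
  have hp0 : 0 < p := by linarith
  have hw : -c - f (v x) = p / (1 + p ^ 2) := by
    have : p / (1 + p ^ 2) = -(ε * v' x / (1 + ε ^ 2 * v' x ^ 2)) := by
      rw [hpdef, neg_div]; ring_nf
    rw [this, hQ]; ring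
  have hw' : p / (1 + p ^ 2) = p⁻¹ / (1 + p⁻¹ ^ 2) := by
    field_simp; ring
  refine ⟨?_, ?_⟩
  · rw [hw]
    refine ⟨by positivity, ?_⟩
    rw [div_lt_div_iff₀ (by positivity) (by norm_num)]
    nlinarith [sq_pos_of_pos (sub_pos.2 hp1)]
  · rw [hw, hw', recipSlope_of_div_one_add_sq (by positivity) (inv_le_one_of_one_le₀ hp1.le)]
    have hv : v' x = -(p * ε⁻¹) := by rw [hpdef]; field_simp
    rw [hv]; field_simp

theorem IsDecSteadyNMsteep.sub_mem_Ioo {l ε um up c : ℝ} {f v v' : ℝ → ℝ} (hε : 0 < ε)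
    (hl : 0 < l) (h : IsDecSteadyNMsteep l ε f um up v v' c) {u : ℝ} (hu : u ∈ Icc up um) :
    -c - f u ∈ Ioo 0 (1 / 2) := by
  have hc : ContinuousOn v (Icc (-l) l) := fun x hx => (h.2.2.1 x hx).continuousAt.continuousWithinAt
  have hsub := intermediate_value_Icc' (by linarith : -l ≤ l) hc
  rw [h.2.2.2.1, h.2.2.2.2.1] at hsub
  obtain ⟨x, hx, rfl⟩ := hsub hu
  exact (h.slope hε hx).1

theorem IsDecSteadyNMsteep.travelTime_eq {l ε um up c : ℝ} {f v v' : ℝ → ℝ} (hε : 0 < ε)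
    (hf : Continuous f) (h : IsDecSteadyNMsteep l ε f um up v v' c) {x : ℝ}
    (hx : x ∈ Icc (-l) l) : travelTime f up (v x) (-c) = (l - x) / ε := by
  have hg : Continuous fun s => recipSlope (-c - f s) := continuous_recipSlope.comp (by fun_prop)
  have hd : ∀ y ∈ Icc (-l) l,
      HasDerivAt (fun y => travelTime f up (v y) (-c) + y / ε) 0 y := by
    intro y hy
    have h1 : HasDerivAt (fun u => travelTime f up u (-c)) (recipSlope (-c - f (v y))) (v y) :=
      intervalIntegral.integral_hasDerivAt_right (hg.intervalIntegrable _ _)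
        hg.stronglyMeasurable.stronglyMeasurableAtFilter hg.continuousAt
    have h2 := (h1.comp y (h.2.2.1 y hy)).add ((hasDerivAt_id y).div_const ε)
    rw [(h.slope hε hy).2, one_div, neg_add_cancel] at h2
    exact h2
  have hll : -l ≤ l := hx.1.trans hx.2
  have hconst := constant_of_has_deriv_right_zero
    (f := fun y => travelTime f up (v y) (-c) + y / ε)
    (fun y hy => (hd y hy).continuousAt.continuousWithinAt)
    (fun y hy => (hd y (Ico_subset_Icc_self hy)).hasDerivWithinAt)
  have e1 := hconst x hx
  have e2 := hconst l (right_mem_Icc.2 hll)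
  have e3 : travelTime f up (v l) (-c) = 0 := by
    rw [h.2.2.2.2.1]; exact intervalIntegral.integral_same
  simp only [e3] at e1 e2
  rw [sub_div]; linarith

theorem exists_isDecSteadyNMsteep {l ε um up k : ℝ} {f : ℝ → ℝ} (hε : 0 < ε)
    (hu : up < um) (hf : Continuous f) (hk : ∀ u ∈ Icc up um, k - f u ∈ Ioo 0 (1 / 2))
    (hT : travelTime f up um k = 2 * l / ε) :
    ∃ v v' c, IsDecSteadyNMsteep l ε f um up v v' c := by
  set g : ℝ → ℝ := fun u => recipSlope (k - f (projIcc up um hu.le u)) with hgdef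
  have hg : Continuous g := continuous_recipSlope.comp
    (continuous_const.sub (hf.comp (continuous_subtype_val.comp continuous_projIcc)))
  have hgeq : ∀ u ∈ Icc up um, g u = recipSlope (k - f u) := fun u hu' => by
    simp only [hgdef, projIcc_of_mem hu.le hu']
  obtain ⟨δ, hδ, hle⟩ : ∃ δ, 0 < δ ∧ ∀ u, δ ≤ g u := by
    obtain ⟨u₀, hu₀, hmin⟩ := isCompact_Icc.exists_isMinOn (nonempty_Icc.2 hu.le)
      (continuous_recipSlope.comp (continuous_const.sub hf : Continuous fun u => k - f u)).continuousOn
    exact ⟨_, recipSlope_pos (hk u₀ hu₀).1, fun u => hmin (projIcc up um hu.le u).2⟩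
  obtain ⟨J, hJm, hJc, hJ, hJd⟩ := exists_inverse_primitive hg hδ hle up
  have hJ0 : J 0 = up := by simpa using hJ up
  have hJ1 : J (2 * l / ε) = um := by
    have hHT : ∫ s in up..um, g s = 2 * l / ε := by
      rw [← hT, travelTime]
      refine intervalIntegral.integral_congr fun s hs => ?_
      rw [uIcc_of_le hu.le] at hs
      exact hgeq s hs
    rw [← hHT, hJ]
  set v : ℝ → ℝ := fun x => J ((l - x) / ε) with hv
  have hmem : ∀ x ∈ Icc (-l) l, v x ∈ Icc up um := by
    intro x hx
    rw [← hJ0, ← hJ1]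
    exact ⟨hJm.monotone (div_nonneg (by linarith [hx.2]) hε.le),
      hJm.monotone (div_le_div_of_nonneg_right (by linarith [hx.1]) hε.le)⟩
  have hvc : Continuous v := hJc.comp (by fun_prop)
  refine ⟨v, fun x => (g (v x))⁻¹ * (-1 / ε), -k, ?_, ?_, ?_, ?_, ?_, ?_, ?_⟩
  · intro x _ y _ hxy
    exact hJm (div_lt_div_of_pos_right (by linarith) hε)
  · exact (((hg.comp hvc).inv₀ fun x => (hδ.trans_le (hle _)).ne').mul_const _).continuousOn
  · intro x _
    exact (hJd _).comp x (((hasDerivAt_id x).const_sub l).div_const ε)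
  · have hend : (l - -l) / ε = 2 * l / ε := by ring
    simp only [hv, hend, hJ1]
  · simp [hv, hJ0]
  · intro x hx
    have hw := hk _ (hmem x hx)
    have hlt : g (v x) < 1 := by
      rw [hgeq _ (hmem x hx), ← recipSlope_half]
      exact recipSlope_strictMonoOn hw.1.le (by norm_num) hw.2
    have hinv := (one_lt_inv₀ (hδ.trans_le (hle (v x)))).2 hlt
    have := mul_lt_mul_of_pos_right hinv (inv_pos.2 hε)
    rw [neg_div, one_div]; linarith
  · intro x hx
    have hw := hk _ (hmem x hx)
    have h1 := recipSlope_div_one_add_sq hw.1.le hw.2.le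
    rw [← hgeq _ (hmem x hx)] at h1
    have hpos := hδ.trans_le (hle (v x))
    have h2 : f (v x) + -k = -(g (v x) / (1 + g (v x) ^ 2)) := by rw [h1]; ring
    rw [h2]
    simp only
    field_simp
    ring

theorem travelTime_eq_Lminus (f : ℝ → ℝ) (a b M : ℝ) :
    travelTime f a b M =
      ∫ s in a..b, 2 * (M - f s) / (1 + Real.sqrt (1 - 4 * (f s - M) ^ 2)) := by
  unfold travelTime recipSlope
  congr 1; ext s
  rw [sub_sq_comm]

theorem travelTime_eq_Lplus (f : ℝ → ℝ) (a b m : ℝ) :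
    travelTime f a b (m + 1 / 2) = ∫ s in a..b,
      (1 - 2 * (f s - m)) / (1 + 2 * Real.sqrt ((f s - m) * (1 - (f s - m)))) := by
  unfold travelTime recipSlope
  congr 1; ext s
  have h4 : (1 : ℝ) - 4 * (m + 1 / 2 - f s) ^ 2 = 2 ^ 2 * ((f s - m) * (1 - (f s - m))) := by ring
  rw [h4, Real.sqrt_mul (by norm_num), Real.sqrt_sq (by norm_num)]
  congr 1; ring

theorem stmt_4
    (ε l : ℝ) (hε : 0 < ε) (hl : 0 < l)
    (f : ℝ → ℝ) (hf : ContDiff ℝ 2 f)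
    (um up : ℝ) (hu : up < um)
    (m M Lminus Lplus : ℝ)
    (hm : IsLeast (f '' Set.Icc up um) m)
    (hM : IsGreatest (f '' Set.Icc up um) M)
    (hLminus : Lminus = ∫ s in up..um,
      2 * (M - f s) / (1 + Real.sqrt (1 - 4 * (f s - M) ^ 2)))
    (hLplus : Lplus = ∫ s in up..um,
      (1 - 2 * (f s - m)) / (1 + 2 * Real.sqrt ((f s - m) * (1 - (f s - m))))) :
    ((∃ v v' c, IsDecSteadyNMsteep l ε f um up v v' c) ∧
      ∀ v₁ v₁' c₁ v₂ v₂' c₂,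
        IsDecSteadyNMsteep l ε f um up v₁ v₁' c₁ →
        IsDecSteadyNMsteep l ε f um up v₂ v₂' c₂ →
        Set.EqOn v₁ v₂ (Set.Icc (-l) l)) ↔
      (M - m < 1 / 2 ∧ Lminus < 2 * l / ε ∧ 2 * l / ε < Lplus) := by
  have hfc : Continuous f := hf.continuous
  have hfM : ∀ u ∈ Icc up um, f u ≤ M := fun u hu' => hM.2 (mem_image_of_mem f hu')
  have hfm : ∀ u ∈ Icc up um, m ≤ f u := fun u hu' => hm.2 (mem_image_of_mem f hu')
  obtain ⟨uM, huM, rfl⟩ := hM.1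
  obtain ⟨u₀, hu₀, rfl⟩ := hm.1
  rw [← travelTime_eq_Lminus] at hLminus
  rw [← travelTime_eq_Lplus] at hLplus
  have hT := travelTime_strictMonoOn hfc hu hfM
  have htime : ∀ {v v' c}, IsDecSteadyNMsteep l ε f um up v v' c →
      f uM < -c ∧ -c < f u₀ + 1 / 2 ∧ travelTime f up um (-c) = 2 * l / ε := by
    intro v v' c h
    have h3 := h.travelTime_eq hε hfc (left_mem_Icc.2 (by linarith))
    rw [h.2.2.2.1] at h3
    refine ⟨by linarith [(h.sub_mem_Ioo hε hl huM).1], by linarith [(h.sub_mem_Ioo hε hl hu₀).2], ?_⟩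
    rw [h3]; ring
  constructor
  · rintro ⟨⟨v, v', c, h⟩, -⟩
    obtain ⟨h1, h2, h3⟩ := htime h
    refine ⟨by linarith, ?_, ?_⟩
    · rw [hLminus, ← h3]
      exact hT self_mem_Ici h1.le h1
    · rw [hLplus, ← h3]
      exact hT h1.le (h1.trans h2).le h2
  · rintro ⟨hosc, hlo, hhi⟩
    refine ⟨?_, ?_⟩
    · rw [hLminus] at hlo
      rw [hLplus] at hhi
      obtain ⟨k, hk, hkT⟩ := intermediate_value_Ioo (by linarith : f uM ≤ f u₀ + 1 / 2)
        (continuous_travelTime hfc up um).continuousOn ⟨hlo, hhi⟩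
      exact exists_isDecSteadyNMsteep hε hu hfc
        (fun u hu' => ⟨by linarith [hfM u hu', hk.1], by linarith [hfm u hu', hk.2]⟩) hkT
    · intro v₁ v₁' c₁ v₂ v₂' c₂ h₁ h₂ x hx
      obtain ⟨hM₁, -, hT₁⟩ := htime h₁
      obtain ⟨hM₂, -, hT₂⟩ := htime h₂
      have hc : c₁ = c₂ := neg_injective (hT.injOn hM₁.le hM₂.le (hT₁.trans hT₂.symm))
      subst hc
      have heq := (h₁.travelTime_eq hε hfc hx).trans (h₂.travelTime_eq hε hfc hx).symm
      have hmono : StrictMonoOn (fun u => travelTime f up u (-c₁)) (Icc up um) := by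
        have hg : Continuous fun s => recipSlope (-c₁ - f s) :=
          continuous_recipSlope.comp (by fun_prop)
        intro a ha b hb hab
        have hpos : 0 < ∫ s in a..b, recipSlope (-c₁ - f s) :=
          intervalIntegral.intervalIntegral_pos_of_pos_on (hg.intervalIntegrable _ _)
            (fun s hs => recipSlope_pos
              (by linarith [hfM s ⟨ha.1.trans hs.1.le, hs.2.le.trans hb.2⟩])) hab
        have hadd := intervalIntegral.integral_add_adjacent_intervals
          (hg.intervalIntegrable (μ := volume) up a) (hg.intervalIntegrable a b)
        simp only [travelTime]
        linarith
      exact hmono.injOn (h₁.mem_Icc hl hx) (h₂.mem_Icc hl hx) heq
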